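/- Let φ be a random perfect matching of ℤ which is stationary and strongly ergodic. Then almost surely, for every j ∈ ℤ there exists k ≥ j with φ(k) ≤ j − 1. If moreover φ is almost surely non-crossing, then almost surely, for every j ∈ ℤ there are infinitely many integers k ≥ j with φ(k) ≤ j − 1. -/

import Mathlib

open MeasureTheory ProbabilityTheory

noncomputable section

/-- `φ` is a perfect matching of `ℤ`: a fixed-point-free involution. -/
def IsMatching (φ : ℤ → ℤ) : Prop := (∀ k, φ k ≠ k) ∧ (∀ k, φ (φ k) = k)

/-- `φ` is non-crossing: there are no integers `j₁ < j₂ < φ j₁ < φ j₂`. -/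
def NonCrossing (φ : ℤ → ℤ) : Prop :=
  ¬ ∃ j₁ j₂ : ℤ, j₁ < j₂ ∧ j₂ < φ j₁ ∧ φ j₁ < φ j₂

/-- The shift of a matching by `m`: `k ↦ φ (k + m) - m`. -/
def shiftM (m : ℤ) (φ : ℤ → ℤ) : ℤ → ℤ := fun k => φ (k + m) - m

/-- The integers `k ≥ j` matched to the left of `j`; they label the arcs over `j - 1/2`. -/
def crossingSet (φ : ℤ → ℤ) (j : ℤ) : Set ℤ := {k | j ≤ k ∧ φ k ≤ j - 1}

/-- The matchings with finitely many arcs over `j - 1/2`, in number congruent to `q` mod 2. -/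
def finiteCrossing (j : ℤ) (q : ZMod 2) : Set (ℤ → ℤ) :=
  {φ | IsMatching φ ∧ ∃ s : Finset ℤ, (s.card : ZMod 2) = q ∧ ∀ k, k ∈ s ↔ k ∈ crossingSet φ j}

theorem isMatching_shiftM_iff (m : ℤ) (φ : ℤ → ℤ) : IsMatching (shiftM m φ) ↔ IsMatching φ := by
  constructor
  · rintro ⟨h₁, h₂⟩
    refine ⟨fun k hk => h₁ (k - m) ?_, fun k => ?_⟩
    · simp [shiftM, hk]
    · have := h₂ (k - m)
      simpa [shiftM] using this
  · rintro ⟨h₁, h₂⟩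
    refine ⟨fun k hk => h₁ (k + m) ?_, fun k => ?_⟩
    · simp only [shiftM] at hk
      omega
    · simp [shiftM, h₂]

theorem mem_crossingSet_shiftM (m j k : ℤ) (φ : ℤ → ℤ) :
    k ∈ crossingSet (shiftM m φ) j ↔ k + m ∈ crossingSet φ (j + m) := by
  simp only [crossingSet, shiftM, Set.mem_ofPred_eq]
  omega

theorem shiftM_mem_finiteCrossing_iff (m j : ℤ) (q : ZMod 2) (φ : ℤ → ℤ) :
    shiftM m φ ∈ finiteCrossing j q ↔ φ ∈ finiteCrossing (j + m) q := by
  simp only [finiteCrossing, Set.mem_ofPred_eq, isMatching_shiftM_iff, mem_crossingSet_shiftM]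
  refine and_congr_right fun _ => ⟨?_, ?_⟩
  · rintro ⟨s, hs, h⟩
    refine ⟨s.map (Equiv.addRight m).toEmbedding, by simpa using hs, fun k => ?_⟩
    rw [Finset.mem_map_equiv, h]
    simp
  · rintro ⟨s, hs, h⟩
    refine ⟨s.map (Equiv.addRight (-m)).toEmbedding, by simpa using hs, fun k => ?_⟩
    rw [Finset.mem_map_equiv, h]
    simp

theorem crossingSet_succ_of_lt {φ : ℤ → ℤ} (hφ : IsMatching φ) {j : ℤ} (hj : j < φ j) (k : ℤ) :
    k ∈ crossingSet φ (j + 1) ↔ k = φ j ∨ k ∈ crossingSet φ j := by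
  have h₁ := hφ.2 j
  have h₂ := hφ.2 k
  simp only [crossingSet, Set.mem_ofPred_eq]
  constructor
  · rintro ⟨h, h'⟩
    by_cases hk : φ k = j
    · left; rw [← hk, h₂]
    · right; omega
  · rintro (rfl | ⟨h, h'⟩)
    · omega
    · have : k ≠ j := by rintro rfl; omega
      omega

theorem crossingSet_of_lt {φ : ℤ → ℤ} (hφ : IsMatching φ) {j : ℤ} (hj : φ j < j) (k : ℤ) :
    k ∈ crossingSet φ j ↔ k = j ∨ k ∈ crossingSet φ (j + 1) := by
  have h₁ := hφ.2 j
  have h₂ := hφ.2 k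
  simp only [crossingSet, Set.mem_ofPred_eq]
  constructor
  · rintro ⟨h, h'⟩
    omega
  · rintro (rfl | ⟨h, h'⟩)
    · omega
    · have : φ k ≠ j := by
        intro hk
        rw [hk] at h₂
        omega
      omega

/-- Inserting or erasing one point in a set shifts the parity of its cardinality. -/
theorem exists_finset_card_add_one_iff {A B : ℤ → Prop} {a : ℤ} (ha : ¬ A a)
    (h : ∀ k, B k ↔ k = a ∨ A k) (q : ZMod 2) :
    (∃ s : Finset ℤ, (s.card : ZMod 2) = q ∧ ∀ k, k ∈ s ↔ A k) ↔
      ∃ s : Finset ℤ, (s.card : ZMod 2) = q + 1 ∧ ∀ k, k ∈ s ↔ B k := by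
  constructor
  · rintro ⟨s, hs, hA⟩
    refine ⟨insert a s, ?_, fun k => by simp [hA, h]⟩
    rw [Finset.card_insert_of_notMem (by rwa [hA])]
    push_cast
    rw [hs]
  · rintro ⟨s, hs, hB⟩
    have has : a ∈ s := by simp [hB, h]
    refine ⟨s.erase a, ?_, fun k => ?_⟩
    · rw [← Finset.card_erase_add_one has] at hs
      push_cast at hs
      exact add_right_cancel hs
    · rw [Finset.mem_erase, hB, h]
      by_cases hk : k = a
      · simp [hk, ha]
      · simp [hk]

theorem finiteCrossing_succ (j : ℤ) (q : ZMod 2) :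
    finiteCrossing (j + 1) (q + 1) = finiteCrossing j q := by
  ext φ
  refine and_congr_right fun hφ => ?_
  rcases lt_or_gt_of_ne (hφ.1 j) with hj | hj
  · rw [exists_finset_card_add_one_iff (a := j) (by simp [crossingSet])
      (crossingSet_of_lt hφ hj) (q + 1), add_assoc, CharTwo.add_self_eq_zero, add_zero]
  · exact (exists_finset_card_add_one_iff (a := φ j) (by simp [crossingSet, hφ.2 j])
      (crossingSet_succ_of_lt hφ hj) q).symm

theorem finiteCrossing_add_intCast (m : ℤ) : ∀ (j : ℤ) (q : ZMod 2),
    finiteCrossing (j + m) (q + m) = finiteCrossing j q := by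
  induction m using Int.induction_on with
  | zero => simp
  | succ n ih =>
    intro j q
    rw [← ih j q, ← finiteCrossing_succ (j + n)]
    push_cast
    simp only [add_assoc]
  | pred n ih =>
    intro j q
    rw [← ih j q, ← finiteCrossing_succ]
    push_cast
    congr 1 <;> ring

theorem measurableSet_finiteCrossing (j : ℤ) (q : ZMod 2) :
    MeasurableSet (finiteCrossing j q) := by
  have hev (k : ℤ) (t : Set ℤ) : MeasurableSet {φ : ℤ → ℤ | φ k ∈ t} :=
    measurable_pi_apply k (MeasurableSet.of_discrete (s := t))
  refine MeasurableSet.inter (MeasurableSet.inter ?_ ?_) ?_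
  · exact measurableSet_setOfPred.2 (.forall fun k => measurableSet_setOfPred.1 (hev k {k}ᶜ))
  · have : (fun φ : ℤ → ℤ => ∀ k, φ (φ k) = k) = fun φ => ∀ k, ∃ n, φ k = n ∧ φ n = k := by
      simp
    rw [this]
    exact measurableSet_setOfPred.2 (.forall fun k => .exists fun n =>
      (measurableSet_setOfPred.1 (hev k {n})).and (measurableSet_setOfPred.1 (hev n {k})))
  · exact measurableSet_setOfPred.2 (.exists fun s => measurable_const.and (.forall fun k =>
      measurable_const.iff
        (measurable_const.and (measurableSet_setOfPred.1 (hev k (Set.Iic (j - 1)))))))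

theorem disjoint_finiteCrossing (j : ℤ) {q r : ZMod 2} (h : q ≠ r) :
    Disjoint (finiteCrossing j q) (finiteCrossing j r) := by
  rw [Set.disjoint_left]
  rintro φ ⟨_, s, hs, hs'⟩ ⟨_, t, ht, ht'⟩
  have : s = t := by
    ext k
    rw [hs', ht']
  exact h (by rw [← hs, ← ht, this])

theorem measurable_shiftM (m : ℤ) : Measurable (shiftM m) :=
  measurable_pi_lambda _ fun k => (measurable_pi_apply (X := fun _ : ℤ => ℤ) (k + m)).sub_const m

theorem preimage_shiftM_finiteCrossing_zero (m : ℤ) (q : ZMod 2) :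
    shiftM m ⁻¹' finiteCrossing 0 (q + m) = finiteCrossing 0 q := by
  ext φ
  rw [Set.mem_preimage, shiftM_mem_finiteCrossing_iff, finiteCrossing_add_intCast]

/-- Under stationarity and strong ergodicity, infinitely many arcs pass over each point. -/
theorem ae_infinite_crossingSet {Ω : Type*} [MeasurableSpace Ω] (μ : Measure Ω)
    [IsProbabilityMeasure μ] (Φ : Ω → ℤ → ℤ) (hmeas : Measurable Φ)
    (hmatch : ∀ᵐ ω ∂μ, IsMatching (Φ ω))
    (hstat : ∀ m : ℤ, μ.map (fun ω => shiftM m (Φ ω)) = μ.map Φ)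
    (herg : ∀ S : Set (ℤ → ℤ), MeasurableSet S →
      (∀ m : ℤ, shiftM (2 * m) ⁻¹' S = S) →
      μ (Φ ⁻¹' S) = 0 ∨ μ (Φ ⁻¹' S) = 1) :
    ∀ᵐ ω ∂μ, ∀ j : ℤ, (crossingSet (Φ ω) j).Infinite := by
  have hzo (q : ZMod 2) := herg _ (measurableSet_finiteCrossing 0 q) fun m => by
    have h := preimage_shiftM_finiteCrossing_zero (2 * m) q
    rwa [show ((2 * m : ℤ) : ZMod 2) = 0 by
      push_cast; rw [show (2 : ZMod 2) = 0 from rfl, zero_mul], add_zero] at h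
  have hswap (q : ZMod 2) :
      μ (Φ ⁻¹' finiteCrossing 0 q) = μ (Φ ⁻¹' finiteCrossing 0 (q + 1)) := by
    have hT := measurableSet_finiteCrossing 0 (q + 1)
    rw [← Measure.map_apply hmeas hT, ← hstat 1,
      Measure.map_apply (f := fun ω => shiftM 1 (Φ ω)) ((measurable_shiftM 1).comp hmeas) hT]
    congr 1
    have h := preimage_shiftM_finiteCrossing_zero 1 q
    rw [Int.cast_one] at h
    rw [← h]
    rfl
  have hnull (q : ZMod 2) : μ (Φ ⁻¹' finiteCrossing 0 q) = 0 := by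
    refine (hzo q).resolve_right fun h => ?_
    have hu := measure_union (μ := μ)
      ((disjoint_finiteCrossing 0 (q := q) (r := q + 1) (by simp)).preimage Φ)
      (hmeas (measurableSet_finiteCrossing 0 (q + 1)))
    rw [← hswap q, h] at hu
    have hle := prob_le_one (μ := μ)
      (s := Φ ⁻¹' finiteCrossing 0 q ∪ Φ ⁻¹' finiteCrossing 0 (q + 1))
    rw [hu] at hle
    norm_num at hle
  have hae : ∀ᵐ ω ∂μ, ∀ q, Φ ω ∉ finiteCrossing 0 q :=
    ae_all_iff.2 fun q => measure_eq_zero_iff_ae_notMem.1 (hnull q)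
  filter_upwards [hmatch, hae] with ω hω hnot j hfin
  refine hnot ((hfin.toFinset.card : ZMod 2) - j) ?_
  rw [← finiteCrossing_add_intCast j, zero_add, sub_add_cancel]
  exact ⟨hω, hfin.toFinset, rfl, fun k => hfin.mem_toFinset⟩

/-- Lemma 6.9 of Goldschmidt–Gwynne–Pfeffer.  Let `Φ` be a random
perfect matching of `ℤ` which is stationary (every shift of `Φ` has the same law as
`Φ`) and strongly ergodic (every event invariant under all even shifts has probability
zero or one).  Then almost surely, for every `j ∈ ℤ` there is `k ≥ j` with
`Φ k ≤ j - 1`.  If moreover `Φ` is almost surely non-crossing, then almost surely, for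
every `j ∈ ℤ` there are infinitely many integers `k ≥ j` with `Φ k ≤ j - 1`. -/
theorem stmt18 {Ω : Type*} [MeasurableSpace Ω] (μ : Measure Ω) [IsProbabilityMeasure μ]
    (Φ : Ω → ℤ → ℤ) (hmeas : Measurable Φ)
    (hmatch : ∀ᵐ ω ∂μ, IsMatching (Φ ω))
    (hstat : ∀ m : ℤ, μ.map (fun ω => shiftM m (Φ ω)) = μ.map Φ)
    (herg : ∀ S : Set (ℤ → ℤ), MeasurableSet S →
      (∀ m : ℤ, shiftM (2 * m) ⁻¹' S = S) →
      μ (Φ ⁻¹' S) = 0 ∨ μ (Φ ⁻¹' S) = 1) :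
    (∀ᵐ ω ∂μ, ∀ j : ℤ, ∃ k : ℤ, j ≤ k ∧ Φ ω k ≤ j - 1) ∧
    ((∀ᵐ ω ∂μ, NonCrossing (Φ ω)) →
      ∀ᵐ ω ∂μ, ∀ j : ℤ, {k : ℤ | j ≤ k ∧ Φ ω k ≤ j - 1}.Infinite) := by
  have h := ae_infinite_crossingSet μ Φ hmeas hmatch hstat herg
  refine ⟨?_, fun _ => h⟩
  filter_upwards [h] with ω hω j
  exact (hω j).nonempty
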